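/- Let Λ > 0, U > 0 and R > r_c := √(3/Λ). Then for every (u₁,r₁) ∈ [0,U]×(r_c, R], with s ↦ r(s) the characteristic through (u₁,r₁), one has 1 − e^{−(Λ/3)∫₀^{u₁} r(s) ds} ≤ 1 − (3/Λ) e^{−√(Λ/3) U} / R² < 1. -/

import Mathlib

open Real Set

/-- `χ` is the characteristic through `(u₁,r₁)`: it solves
`χ' = -(1/2)(1 - (Λ/3) χ²)` on `[0,u₁]` with `χ(u₁) = r₁`. -/
def IsChar (Λ u₁ r₁ : ℝ) (χ : ℝ → ℝ) : Prop :=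
  χ u₁ = r₁ ∧ ∀ s ∈ Set.Icc 0 u₁, HasDerivAt χ (-(1/2) * (1 - Λ/3 * (χ s)^2)) s

/-- A solution of the scalar linear equation `f' = a f` on `[t₀,t₁]` is given by the exponential of
the integral of its coefficient. -/
theorem eq_mul_exp_integral_of_hasDerivAt_linear {f a : ℝ → ℝ} {t₀ t₁ : ℝ} (h : t₀ ≤ t₁)
    (ha : ContinuousOn a (Icc t₀ t₁)) (hf : ∀ s ∈ Icc t₀ t₁, HasDerivAt f (a s * f s) s) :
    f t₁ = f t₀ * exp (∫ s in t₀..t₁, a s) := by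
  set b : ℝ → ℝ := IccExtend h ((Icc t₀ t₁).domRestrict a)
  have hb : Continuous b := (continuousOn_iff_continuous_domRestrict.mp ha).Icc_extend'
  have hba : ∀ s ∈ Icc t₀ t₁, b s = a s := fun s hs => IccExtend_of_mem h _ hs
  have hg : ∀ s ∈ Icc t₀ t₁,
      HasDerivAt (fun t => f t * exp (-∫ x in t₀..t, b x)) 0 s := by
    intro s hs
    have hB : HasDerivAt (fun t => ∫ x in t₀..t, b x) (b s) s :=
      hb.integral_hasStrictDerivAt t₀ s |>.hasDerivAt
    refine ((hf s hs).mul hB.neg.exp).congr_deriv ?_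
    rw [hba s hs]
    ring
  have hconst := constant_of_has_deriv_right_zero
    (fun s hs => (hg s hs).continuousAt.continuousWithinAt)
    (fun s hs => (hg s (Ico_subset_Icc_self hs)).hasDerivWithinAt) t₁ (right_mem_Icc.mpr h)
  have hint : ∫ x in t₀..t₁, b x = ∫ x in t₀..t₁, a x :=
    intervalIntegral.integral_congr fun s hs => hba s (by rwa [uIcc_of_le h] at hs)
  simp only [intervalIntegral.integral_same, neg_zero, exp_zero, mul_one, hint] at hconst
  rw [← hconst, mul_assoc, ← exp_add, neg_add_cancel, exp_zero, mul_one]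

/-- Contraction factor estimate in the cosmological region: for
`U > 0`, `R > r_c = √(3/Λ)` and `(u₁,r₁) ∈ [0,U] × (r_c,R]`, with `χ` the
characteristic through `(u₁,r₁)`,
`1 - e^{-(Λ/3)∫₀^{u₁} χ} ≤ 1 - (3/Λ) e^{-√(Λ/3) U} / R² < 1`. -/
theorem contraction_factor_cosmological
    (Λ U R : ℝ) (hΛ : 0 < Λ) (hU : 0 < U) (hR : Real.sqrt (3 / Λ) < R)
    (u₁ r₁ : ℝ) (hu₁ : u₁ ∈ Set.Icc 0 U)
    (hr₁ : r₁ ∈ Set.Ioc (Real.sqrt (3 / Λ)) R)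
    (χ : ℝ → ℝ) (hχ : IsChar Λ u₁ r₁ χ) :
    1 - Real.exp (-(Λ/3) * ∫ s in (0:ℝ)..u₁, χ s)
        ≤ 1 - (3 / Λ) * Real.exp (-Real.sqrt (Λ / 3) * U) / R ^ 2 ∧
      1 - (3 / Λ) * Real.exp (-Real.sqrt (Λ / 3) * U) / R ^ 2 < 1 := by
  obtain ⟨hend, hode⟩ := hχ
  obtain ⟨h0, hU₁⟩ := hu₁
  obtain ⟨hr, hrR⟩ := hr₁
  set c := √(3 / Λ)
  set k := √(Λ / 3)
  have hc : 0 < c := by positivity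
  have hc2 : c ^ 2 = 3 / Λ := sq_sqrt (by positivity)
  have hk2 : k ^ 2 = Λ / 3 := sq_sqrt (by positivity)
  have hkc : k * c = 1 := by
    rw [← sqrt_mul (by positivity), show Λ / 3 * (3 / Λ) = 1 by field_simp, sqrt_one]
  have hR0 : 0 < R := hc.trans hR
  have hcont : ContinuousOn χ (Icc 0 u₁) := fun s hs =>
    (hode s hs).continuousAt.continuousWithinAt
  have hplus := eq_mul_exp_integral_of_hasDerivAt_linear (f := fun s => χ s + c)
    (a := fun s => Λ / 6 * (χ s - c)) h0 (by fun_prop) fun s hs => by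
      refine ((hode s hs).add_const c).congr_deriv ?_
      linear_combination ((k * c + 1) / 2) * hkc - c ^ 2 / 2 * hk2
  have hminus := eq_mul_exp_integral_of_hasDerivAt_linear (f := fun s => χ s - c)
    (a := fun s => Λ / 6 * (χ s + c)) h0 (by fun_prop) fun s hs => by
      refine ((hode s hs).sub_const c).congr_deriv ?_
      linear_combination ((k * c + 1) / 2) * hkc - c ^ 2 / 2 * hk2
  have hχ0 : c < χ 0 := by
    have : 0 < (χ 0 - c) * exp (∫ s in (0 : ℝ)..u₁, Λ / 6 * (χ s + c)) := by
      rw [← hminus, hend]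
      exact sub_pos.mpr hr
    exact sub_pos.mp (pos_of_mul_pos_left this (exp_pos _).le)
  have hint : ∫ s in (0 : ℝ)..u₁, Λ / 6 * (χ s - c) =
      Λ / 6 * (∫ s in (0 : ℝ)..u₁, χ s) - k * u₁ / 2 := by
    rw [intervalIntegral.integral_const_mul, intervalIntegral.integral_sub
      (hcont.intervalIntegrable_of_Icc h0) intervalIntegrable_const,
      intervalIntegral.integral_const, smul_eq_mul]
    linear_combination (u₁ * c / 2) * hk2 - (k * u₁ / 2) * hkc
  simp only [hend] at hplus
  rw [hint] at hplus
  have hexp : exp (-(Λ / 3) * ∫ s in (0 : ℝ)..u₁, χ s) =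
      exp (-k * u₁) * ((χ 0 + c) / (r₁ + c)) ^ 2 := by
    have hv : 0 < χ 0 + c := by linarith
    rw [hplus, div_mul_cancel_left₀ hv.ne', ← exp_neg, ← exp_nat_mul, ← exp_add]
    congr 1
    push_cast
    ring
  have hratio : c / R ≤ (χ 0 + c) / (r₁ + c) := by
    rw [div_le_div_iff₀ hR0 (by linarith)]
    nlinarith
  refine ⟨?_, sub_lt_self 1 (by positivity)⟩
  rw [hexp, ← hc2]
  have hle : exp (-k * U) * (c / R) ^ 2 ≤
      exp (-k * u₁) * ((χ 0 + c) / (r₁ + c)) ^ 2 := by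
    have hk : 0 ≤ k := sqrt_nonneg _
    gcongr ?_ * ?_
    · exact exp_le_exp.mpr (by nlinarith)
    · gcongr
  rw [div_pow, ← mul_div_assoc, mul_comm (exp (-k * U))] at hle
  linarith
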